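/- arXiv:0809.0476 — 2 statements merged into one kernel-verified Lean document; each statement's English description precedes it below -/
import Mathlib

section
/- Let S be a symmetric numerical semigroup with Frobenius number f and multiplicity e = a_1. Then σ(α) = ord(f + α) for every α ∈ {1, …, e}, and consequently g(u) = min{ord(f + α) | α ∈ 𝒜(u)} for every nonzero u ∈ S. -/
namespace GotoNS

/-- `S` is a numerical semigroup: an additive submonoid of `ℕ` with finite
complement, different from `ℕ` itself. -/
def IsNumericalSemigroup (S : Set ℕ) : Prop :=
  (0 : ℕ) ∈ S ∧ (∀ a b, a ∈ S → b ∈ S → a + b ∈ S) ∧ Sᶜ.Finite ∧ S ≠ Set.univ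

/-- The multiplicity `e` of `S`: its smallest nonzero element. -/
noncomputable def mult (S : Set ℕ) : ℕ := sInf {n | n ∈ S ∧ n ≠ 0}

/-- The Frobenius number `f` of `S`: the largest integer not in `S`. -/
noncomputable def frob (S : Set ℕ) : ℕ := sSup {n | n ∉ S}

/-- The `k`-fold sumset `kM` of `M = S \ {0}` (with `0M = {0}`). -/
def kfold (S : Set ℕ) (k : ℕ) : Set ℕ :=
  {s | ∃ c : Fin k → ℕ, (∀ i, c i ∈ S ∧ c i ≠ 0) ∧ ∑ i, c i = s}

/-- The order of `s`: the largest `k` such that `s` is a sum of `k` nonzero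
elements of `S` (`ord 0 = 0`; junk value `0` off `S`). -/
noncomputable def ordS (S : Set ℕ) (s : ℕ) : ℕ := sSup {k | s ∈ kfold S k}

/-- The Apéry set `Ap(S; n) = {w ∈ S | w - n ∉ S}`. -/
def apery (S : Set ℕ) (n : ℕ) : Set ℕ := {w | w ∈ S ∧ ∀ s ∈ S, s + n ≠ w}

/-- `σ(α) = max {ord w | w ∈ Ap(S; α)}`. -/
noncomputable def sigmaS (S : Set ℕ) (α : ℕ) : ℕ := sSup (ordS S '' apery S α)

/-- `𝒜(u) = {α ∈ {1, …, e} | u - α ∈ S}`. -/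
def Aset (S : Set ℕ) (u : ℕ) : Set ℕ :=
  {α | 1 ≤ α ∧ α ≤ mult S ∧ ∃ s ∈ S, s + α = u}

/-- The Goto number `g(u) = min {σ(α) | α ∈ 𝒜(u)}`. -/
noncomputable def goto (S : Set ℕ) (u : ℕ) : ℕ := sInf (sigmaS S '' Aset S u)

/-- `τ`: the minimal Goto number of a nonzero element of `S`. -/
noncomputable def tau (S : Set ℕ) : ℕ := sInf (goto S '' {u | u ∈ S ∧ u ≠ 0})

/-- `ρ`: the maximal Goto number of a nonzero element of `S`. -/
noncomputable def rho (S : Set ℕ) : ℕ := sSup (goto S '' {u | u ∈ S ∧ u ≠ 0})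

/-- An integer belongs to `S` (viewed inside `ℤ`). -/
def memZ (S : Set ℕ) (z : ℤ) : Prop := ∃ n : ℕ, n ∈ S ∧ (n : ℤ) = z

/-- `T = {z ∈ ℤ \ S | z + u ∈ S for all 0 ≠ u ∈ S}`. -/
def Tset (S : Set ℕ) : Set ℤ :=
  {z | ¬ memZ S z ∧ ∀ u : ℕ, u ∈ S → u ≠ 0 → memZ S (z + (u : ℤ))}

open Classical in
/-- The order of an integer, with the convention `ord z = -1` if `z ∉ S`. -/
noncomputable def ordZ (S : Set ℕ) (z : ℤ) : ℤ :=
  if 0 ≤ z ∧ z.toNat ∈ S then (ordS S z.toNat : ℤ) else -1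

/-- `S` is symmetric: for integers `x + y = f`, exactly one of `x, y` lies in `S`. -/
def IsSymmetricNS (S : Set ℕ) : Prop :=
  ∀ x y : ℤ, x + y = (frob S : ℤ) → (memZ S x ↔ ¬ memZ S y)

/-- `u ⪯ u'` iff `u' - u ∈ S`. -/
def preceq (S : Set ℕ) (u u' : ℕ) : Prop := ∃ s ∈ S, u + s = u'

/-- `u ⪯_M u'` iff `u + s = u'` and `ord u + ord s = ord u'` for some `s ∈ S`. -/
def preceqM (S : Set ℕ) (u u' : ℕ) : Prop :=
  ∃ s ∈ S, u + s = u' ∧ ordS S u + ordS S s = ordS S u'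

/-- `Ap(S) \ {0}`. -/
def apNZ (S : Set ℕ) : Set ℕ := apery S (mult S) \ {0}

/-- Minimal elements of `Ap(S) \ {0}` with respect to `⪯`. -/
def minAp (S : Set ℕ) : Set ℕ := {w | w ∈ apNZ S ∧ ∀ w' ∈ apNZ S, preceq S w' w → w' = w}

/-- Maximal elements of `Ap(S) \ {0}` with respect to `⪯`. -/
def maxAp (S : Set ℕ) : Set ℕ := {w | w ∈ apNZ S ∧ ∀ w' ∈ apNZ S, preceq S w w' → w' = w}

/-- Minimal elements of `Ap(S) \ {0}` with respect to `⪯_M`. -/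
def minApM (S : Set ℕ) : Set ℕ := {w | w ∈ apNZ S ∧ ∀ w' ∈ apNZ S, preceqM S w' w → w' = w}

/-- Maximal elements of `Ap(S) \ {0}` with respect to `⪯_M`. -/
def maxApM (S : Set ℕ) : Set ℕ := {w | w ∈ apNZ S ∧ ∀ w' ∈ apNZ S, preceqM S w w' → w' = w}

/-- `S` is pure if all elements of `maxAp S` have the same order. -/
def IsPure (S : Set ℕ) : Prop := ∀ w ∈ maxAp S, ∀ w' ∈ maxAp S, ordS S w = ordS S w'

/-- `S` is `M`-pure if all elements of `maxApM S` have the same order. -/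
def IsMPure (S : Set ℕ) : Prop := ∀ w ∈ maxApM S, ∀ w' ∈ maxApM S, ordS S w = ordS S w'

/-- `S` is `M`-additive if `ord (u + a₁) = ord u + 1` for all `u ∈ S`. -/
def IsMAdditive (S : Set ℕ) : Prop := ∀ u ∈ S, ordS S (u + mult S) = ordS S u + 1

/-- The reduction number `r = min {k | (k+1)M = a₁ + kM}`. -/
noncomputable def redNum (S : Set ℕ) : ℕ :=
  sInf {k | kfold S (k + 1) = (fun x => mult S + x) '' kfold S k}

/-- The set of minimal generators of `S`: nonzero elements of `S` that are not
sums of two nonzero elements of `S`. -/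
def minGens (S : Set ℕ) : Set ℕ :=
  {a | a ∈ S ∧ a ≠ 0 ∧ ∀ x ∈ S, ∀ y ∈ S, x ≠ 0 → y ≠ 0 → x + y ≠ a}

/-- `δ_w = max {ord w + ord w' | w' ∈ S, w + w' ∈ Ap(S)}`. -/
noncomputable def deltaI (S : Set ℕ) (w : ℕ) : ℕ :=
  sSup ((fun w' => ordS S w + ordS S w') '' {w' | w' ∈ S ∧ w + w' ∈ apery S (mult S)})

/-- `δ = min {δ_w | w ∈ Ap(S)}`. -/
noncomputable def deltaNS (S : Set ℕ) : ℕ := sInf (deltaI S '' apery S (mult S))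

/-- `γ_w = max {ord w + ⌊w'/a₁⌋ | w' ∈ S, w + w' ∈ Ap(S)}`. -/
noncomputable def gammaI (S : Set ℕ) (w : ℕ) : ℕ :=
  sSup ((fun w' => ordS S w + w' / mult S) '' {w' | w' ∈ S ∧ w + w' ∈ apery S (mult S)})

/-- `γ = min {γ_w | w ∈ Ap(S)}`. -/
noncomputable def gammaNS (S : Set ℕ) : ℕ := sInf (gammaI S '' apery S (mult S))

/-- `ord(C) = min {ord (f+1), …, ord (f+a₁)}`. -/
noncomputable def ordC (S : Set ℕ) : ℕ :=
  sInf ((fun α => ordS S (frob S + α)) '' Set.Icc 1 (mult S))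


theorem le_of_mem_kfold {S : Set ℕ} {k s : ℕ} (h : s ∈ kfold S k) : k ≤ s := by
  obtain ⟨c, hc, rfl⟩ := h
  calc k = ∑ _i : Fin k, 1 := by simp
    _ ≤ ∑ i, c i := Finset.sum_le_sum fun i _ => Nat.one_le_iff_ne_zero.mpr (hc i).2

theorem bddAbove_kfold (S : Set ℕ) (s : ℕ) : BddAbove {k | s ∈ kfold S k} :=
  ⟨s, fun _ hk => le_of_mem_kfold hk⟩

theorem add_mem_kfold_succ {S : Set ℕ} {k s t : ℕ} (hs : s ∈ kfold S k) (ht : t ∈ S)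
    (ht0 : t ≠ 0) : s + t ∈ kfold S (k + 1) := by
  obtain ⟨c, hc, rfl⟩ := hs
  refine ⟨Fin.cons t c, fun i => ?_, ?_⟩
  · refine Fin.cases ?_ (fun j => ?_) i
    · simpa using ⟨ht, ht0⟩
    · simpa using hc j
  · rw [Fin.sum_univ_succ]
    simp [add_comm]

theorem ordS_le_ordS_add {S : Set ℕ} (s : ℕ) {t : ℕ} (ht : t ∈ S) :
    ordS S s ≤ ordS S (s + t) := by
  rcases eq_or_ne t 0 with rfl | ht0
  · simp
  · exact csSup_le' fun k hk => (Nat.le_succ k).trans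
      (le_csSup (bddAbove_kfold S (s + t)) (add_mem_kfold_succ hk ht ht0))

theorem frob_notMem {S : Set ℕ} (hS : IsNumericalSemigroup S) : frob S ∉ S :=
  Nat.sSup_mem (Set.nonempty_compl.mpr hS.2.2.2) hS.2.2.1.bddAbove

theorem mem_of_frob_lt {S : Set ℕ} (hS : IsNumericalSemigroup S) {n : ℕ} (hn : frob S < n) :
    n ∈ S :=
  not_not.mp fun h => hn.not_ge (le_csSup hS.2.2.1.bddAbove h)

theorem frob_add_mem_apery {S : Set ℕ} (hS : IsNumericalSemigroup S) {α : ℕ} (hα : 1 ≤ α) :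
    frob S + α ∈ apery S α :=
  ⟨mem_of_frob_lt hS (by omega), fun s hs h =>
    frob_notMem hS (Nat.add_right_cancel h ▸ hs)⟩

theorem exists_add_eq_frob_add {S : Set ℕ} (hsym : IsSymmetricNS S) {α w : ℕ}
    (hw : w ∈ apery S α) : ∃ t ∈ S, w + t = frob S + α := by
  have hnot : ¬ memZ S ((w : ℤ) - α) := by
    rintro ⟨n, hn, h⟩
    exact hw.2 n hn (by omega)
  obtain ⟨t, ht, h⟩ := (hsym (frob S - (w - α)) (w - α) (by ring)).mpr hnot
  exact ⟨t, ht, by omega⟩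

theorem sigmaS_eq_ordS {S : Set ℕ} (hS : IsNumericalSemigroup S) (hsym : IsSymmetricNS S)
    {α : ℕ} (hα : 1 ≤ α) : sigmaS S α = ordS S (frob S + α) := by
  refine IsGreatest.csSup_eq ⟨⟨_, frob_add_mem_apery hS hα, rfl⟩, ?_⟩
  rintro _ ⟨w, hw, rfl⟩
  obtain ⟨t, ht, h⟩ := exists_add_eq_frob_add hsym hw
  exact h ▸ ordS_le_ordS_add w ht

/-- for symmetric `S`, `σ(α) = ord (f + α)` and
`g(u) = min {ord (f + α) | α ∈ 𝒜(u)}`. -/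
theorem statement4 (S : Set ℕ) (hS : IsNumericalSemigroup S) (hsym : IsSymmetricNS S) :
    (∀ α ∈ Set.Icc 1 (mult S), sigmaS S α = ordS S (frob S + α)) ∧
    (∀ u ∈ S, u ≠ 0 → goto S u = sInf ((fun α => ordS S (frob S + α)) '' Aset S u)) := by
  refine ⟨fun α hα => sigmaS_eq_ordS hS hsym hα.1, fun u _ _ => ?_⟩
  exact congrArg sInf (Set.image_congr fun α hα => sigmaS_eq_ordS hS hsym hα.1)

end GotoNS
end

section
/- Let S be a numerical semigroup with minimal generators a_1 < … < a_ν and Frobenius number f, let u ∈ S be nonzero, and let ũ be the largest element of S that is strictly smaller than u. Then: (1) g(u) ≤ ⌊(f + u − ũ)/a_1⌋; (2) g(a_1) ≤ ⌊(f + a_1)/a_2⌋; (3) ρ ≤ ⌈f/a_1⌉. -/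
namespace GotoNS

lemma mult_le {S : Set ℕ} {x : ℕ} (hx : x ∈ S) (hx0 : x ≠ 0) : mult S ≤ x :=
  Nat.sInf_le ⟨hx, hx0⟩

lemma mult_mem {S : Set ℕ} {x : ℕ} (hx : x ∈ S) (hx0 : x ≠ 0) : mult S ∈ S ∧ mult S ≠ 0 :=
  Nat.sInf_mem (s := {n | n ∈ S ∧ n ≠ 0}) ⟨x, hx, hx0⟩

lemma le_frob {S : Set ℕ} (hS : Sᶜ.Finite) {n : ℕ} (hn : n ∉ S) : n ≤ frob S :=
  le_csSup (s := {n | n ∉ S}) hS.bddAbove hn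

lemma le_frob_add_of_mem_apery {S : Set ℕ} (hS : Sᶜ.Finite) {α w : ℕ} (hw : w ∈ apery S α) :
    w ≤ frob S + α := by
  rcases le_or_gt w α with h | h
  · omega
  · have : w - α ∉ S := fun hmem => hw.2 _ hmem (by omega)
    have := le_frob hS this
    omega

lemma sigmaS_le {S : Set ℕ} (hS : Sᶜ.Finite) {α d : ℕ} (hd : 0 < d)
    (h : ∀ w ∈ apery S α, ∀ k, ∀ c : Fin k → ℕ, (∀ i, c i ∈ S ∧ c i ≠ 0) → ∑ i, c i = w →
      ∀ i, d ≤ c i) :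
    sigmaS S α ≤ (frob S + α) / d := by
  refine csSup_le' ?_
  rintro _ ⟨w, hw, rfl⟩
  refine csSup_le' ?_
  rintro k ⟨c, hc, hsum⟩
  rw [Nat.le_div_iff_mul_le hd]
  refine le_trans ?_ (le_frob_add_of_mem_apery hS hw)
  rw [← hsum]
  simpa using Finset.card_nsmul_le_sum Finset.univ c d fun i _ => h w hw k c hc hsum i

lemma goto_le_sigmaS {S : Set ℕ} {u α : ℕ} (h : α ∈ Aset S u) : goto S u ≤ sigmaS S α :=
  Nat.sInf_le ⟨α, h, rfl⟩

lemma nsmul_mem {S : Set ℕ} (hS : IsNumericalSemigroup S) {x : ℕ} (hx : x ∈ S) (n : ℕ) :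
    n * x ∈ S := by
  induction n with
  | zero => simpa using hS.1
  | succ n ih => rw [Nat.succ_mul]; exact hS.2.1 _ _ ih hx

lemma sum_mem {S : Set ℕ} (hS : IsNumericalSemigroup S) {ι : Type*} (t : Finset ι) (c : ι → ℕ)
    (hc : ∀ i, c i ∈ S) : ∑ i ∈ t, c i ∈ S :=
  Finset.sum_induction c (· ∈ S) hS.2.1 hS.1 fun i _ => hc i

/-- Two consecutive elements of `S` differ by at most the multiplicity. -/
lemma sub_pred_mem_Aset {S : Set ℕ} (hS : IsNumericalSemigroup S) {u ut : ℕ} (hu : u ∈ S)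
    (hu0 : u ≠ 0) (hut : ut ∈ S) (hutlt : ut < u) (hutmax : ∀ s ∈ S, s < u → s ≤ ut) :
    u - ut ∈ Aset S u := by
  obtain ⟨he, he0⟩ := mult_mem hu hu0
  refine ⟨by omega, ?_, ut, hut, by omega⟩
  have hlt : (u - 1) / mult S * mult S < u := by
    have := Nat.div_mul_le_self (u - 1) (mult S)
    omega
  have h := hutmax _ (nsmul_mem hS he _) hlt
  have h2 := Nat.lt_div_mul_add (a := u - 1) (Nat.pos_of_ne_zero he0)
  omega

lemma exists_minGens_add {S : Set ℕ} (hS : IsNumericalSemigroup S) {x : ℕ} (hx : x ∈ S)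
    (hx0 : x ≠ 0) : ∃ g ∈ minGens S, ∃ s ∈ S, g + s = x := by
  induction x using Nat.strong_induction_on with
  | _ x ih =>
    by_cases h : x ∈ minGens S
    · exact ⟨x, h, 0, hS.1, rfl⟩
    · obtain ⟨y, hy, z, hz, hy0, hz0, hyz⟩ :
          ∃ y ∈ S, ∃ z ∈ S, y ≠ 0 ∧ z ≠ 0 ∧ y + z = x := by
        by_contra! hcon
        exact h ⟨hx, hx0, hcon⟩
      obtain ⟨g, hg, s, hs, rfl⟩ := ih y (by omega) hy hy0
      exact ⟨g, hg, s + z, hS.2.1 _ _ hs hz, by omega⟩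

/-- If every minimal generator other than `e` is at least `d`, then so is every nonzero summand of
an element of `Ap(S; e)`, which bounds `σ(e)`. -/
lemma sigmaS_mult_le {S : Set ℕ} (hS : IsNumericalSemigroup S) {d : ℕ} (hd : 0 < d)
    (h : ∀ g ∈ minGens S, g ≠ mult S → d ≤ g) :
    sigmaS S (mult S) ≤ (frob S + mult S) / d := by
  refine sigmaS_le hS.2.2.1 hd fun w hw k c hc hsum i => ?_
  obtain ⟨g, hg, s, hs, hgs⟩ := exists_minGens_add hS (hc i).1 (hc i).2
  refine (h g hg ?_).trans (by omega)
  rintro rfl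
  refine hw.2 _ (hS.2.1 _ _ hs (sum_mem hS (Finset.univ.erase i) c fun j => (hc j).1)) ?_
  rw [← hsum, ← Finset.add_sum_erase _ c (Finset.mem_univ i)]
  omega

lemma mult_lt_and_le_of_mem_minGens {S : Set ℕ} {ν : ℕ} {a : Fin ν → ℕ} (ha : StrictMono a)
    (hgen : Set.range a = minGens S) (hν : 2 ≤ ν) :
    mult S < a ⟨1, by omega⟩ ∧ ∀ g ∈ minGens S, g ≠ mult S → a ⟨1, by omega⟩ ≤ g := by
  have hmem : ∀ i, a i ∈ minGens S := fun i => hgen ▸ Set.mem_range_self i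
  have h0 := hmem ⟨0, by omega⟩
  obtain ⟨he, he0⟩ := mult_mem h0.1 h0.2.1
  have hle := mult_le h0.1 h0.2.1
  have hegen : mult S ∈ minGens S := by
    refine ⟨he, he0, fun x hx y hy hx0 hy0 hxy => ?_⟩
    have := mult_le hx hx0
    omega
  obtain ⟨j, hj⟩ := hgen.symm ▸ hegen
  have h0e : a ⟨0, by omega⟩ = mult S :=
    le_antisymm (hj ▸ ha.monotone (Fin.mk_le_of_le_val (Nat.zero_le _))) hle
  refine ⟨h0e ▸ ha (by simp), fun g hg hge => ?_⟩
  obtain ⟨i, rfl⟩ := hgen.symm ▸ hg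
  refine ha.monotone (Fin.mk_le_of_le_val (Nat.one_le_iff_ne_zero.2 fun hi => hge ?_))
  rw [← h0e]
  exact congrArg a (Fin.ext hi)

lemma goto_le {S : Set ℕ} (hS : IsNumericalSemigroup S) {u ut : ℕ} (hu : u ∈ S)
    (hu0 : u ≠ 0) (hut : ut ∈ S) (hutlt : ut < u) (hutmax : ∀ s ∈ S, s < u → s ≤ ut) :
    goto S u ≤ (frob S + u - ut) / mult S := by
  rw [Nat.add_sub_assoc hutlt.le]
  exact (goto_le_sigmaS (sub_pred_mem_Aset hS hu hu0 hut hutlt hutmax)).trans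
    (sigmaS_le hS.2.2.1 (Nat.pos_of_ne_zero (mult_mem hu hu0).2)
      fun _ _ _ _ hc _ i => mult_le (hc i).1 (hc i).2)

lemma exists_pred {S : Set ℕ} (hS : IsNumericalSemigroup S) {u : ℕ} (hu0 : u ≠ 0) :
    ∃ ut ∈ S, ut < u ∧ ∀ s ∈ S, s < u → s ≤ ut := by
  have hfin : {s | s ∈ S ∧ s < u}.Finite := (Set.finite_lt_nat u).subset fun s hs => hs.2
  obtain ⟨m, hm, hmax⟩ := hfin.exists_maximal ⟨0, hS.1, Nat.pos_of_ne_zero hu0⟩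
  exact ⟨m, hm.1, hm.2, fun s hs hsu => (le_total s m).elim id fun h => hmax ⟨hs, hsu⟩ h⟩

/-- upper bounds for Goto numbers. -/
theorem statement6 (S : Set ℕ) (hS : IsNumericalSemigroup S)
    (ν : ℕ) (a : Fin ν → ℕ) (ha : StrictMono a) (hgen : Set.range a = minGens S)
    (hν : 2 ≤ ν)
    (u : ℕ) (hu : u ∈ S) (hu0 : u ≠ 0)
    (ut : ℕ) (hut : ut ∈ S) (hutlt : ut < u) (hutmax : ∀ s ∈ S, s < u → s ≤ ut) :
    goto S u ≤ (frob S + u - ut) / mult S ∧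
    goto S (mult S) ≤ (frob S + mult S) / a ⟨1, by omega⟩ ∧
    rho S ≤ (frob S + mult S - 1) / mult S := by
  obtain ⟨hlt, hgens⟩ := mult_lt_and_le_of_mem_minGens ha hgen hν
  have hσ := sigmaS_mult_le hS (by omega) hgens
  obtain ⟨he, he0⟩ := mult_mem hu hu0
  refine ⟨goto_le hS hu hu0 hut hutlt hutmax, ?_, csSup_le' ?_⟩
  · exact (goto_le_sigmaS ⟨by omega, le_rfl, 0, hS.1, by omega⟩).trans hσ
  · rintro _ ⟨v, ⟨hv, hv0⟩, rfl⟩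
    obtain ⟨vt, hvt, hvtlt, hvtmax⟩ := exists_pred hS hv0
    have hA := sub_pred_mem_Aset hS hv hv0 hvt hvtlt hvtmax
    rcases hA.2.1.lt_or_eq with h | h
    · exact (goto_le hS hv hv0 hvt hvtlt hvtmax).trans (Nat.div_le_div_right (by omega))
    · rw [h] at hA
      refine ((goto_le_sigmaS hA).trans hσ).trans ?_
      rw [Nat.le_div_iff_mul_le (by omega)]
      have h1 := Nat.div_mul_le_self (frob S + mult S) (a ⟨1, by omega⟩)
      rcases Nat.eq_zero_or_pos ((frob S + mult S) / a ⟨1, by omega⟩) with h2 | h2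
      · simp [h2]
      · have h3 := Nat.mul_lt_mul_of_pos_left hlt h2
        omega

end GotoNS
end
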